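/- arXiv:2605.00705 — 2 statements merged into one kernel-verified Lean document; each statement's English description precedes it below -/
import Mathlib

section
/- Let 0 ≤ r < n and let J be a finite set of generators each of Hamming distance strictly less than n (hence disjoint from Θ_n), such that J ∪ Θ_n is admissible. Then there is no vertex a ∈ Q_n such that both a and its antipode ā occur as endpoints of (possibly different) generators in J. -/
/-- The integer in `{0, …, 2^n − 1}` corresponding to a vertex of `Q_n` via
binary expansion. -/
def val {n : ℕ} (a : Fin n → Bool) : ℕ := ∑ i, if a i then 2 ^ (i : ℕ) else 0

/-- A generator (for parameters `n, r`): an unordered pair `{a,b}` of distinct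
vertices of `Q_n` with `d_H(a,b) > r`, normalised so that `val fst < val snd`. -/
structure Gen (n r : ℕ) where
  fst : Fin n → Bool
  snd : Fin n → Bool
  hval : val fst < val snd
  hdist : r < hammingDist fst snd

/-- The order on generators: first by Hamming distance, then lexicographically
on the pair of integers (identifying vertices with integers via binary
expansion). -/
def genLT {n r : ℕ} (p q : Gen n r) : Prop :=
  hammingDist p.fst p.snd < hammingDist q.fst q.snd ∨
    (hammingDist p.fst p.snd = hammingDist q.fst q.snd ∧
      (val p.fst < val q.fst ∨ (p.fst = q.fst ∧ val p.snd < val q.snd)))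

/-- The two endpoints of a generator, viewed as a two-element subset of `Q_n`. -/
def ends {n r : ℕ} (p : Gen n r) : Set (Fin n → Bool) := {p.fst, p.snd}

/-- The union of the endpoints of all generators of `I` that are `≤ p`
(the initial segment of `I` determined by `p`). -/
def initUnion {n r : ℕ} (I : Set (Gen n r)) (p : Gen n r) : Set (Fin n → Bool) :=
  {x | ∃ p' ∈ I, (p' = p ∨ genLT p' p) ∧ x ∈ ends p'}

/-- A set `I` of generators is admissible if for every `p ∈ I` and every
generator `q > p`, the two-element set `q` is not contained in the union of the
generators of `I` that are `≤ p`. -/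
def admissible {n r : ℕ} (I : Set (Gen n r)) : Prop :=
  ∀ p ∈ I, ∀ q : Gen n r, genLT p q → ¬ (ends q ⊆ initUnion I p)

/-- `Θ_n`: the set of all antipodal generators `{a, ā}`, i.e. those of Hamming
distance `n`. -/
def Theta (n r : ℕ) : Set (Gen n r) := {p | hammingDist p.fst p.snd = n}

theorem val_eq_head_add_tail {n : ℕ} (a : Fin (n + 1) → Bool) :
    val a = (if a 0 then 1 else 0) + 2 * val (fun i : Fin n => a i.succ) := by
  simp only [val, Fin.sum_univ_succ, Finset.mul_sum, Fin.val_succ, Fin.val_zero, pow_zero]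
  congr 1
  refine Finset.sum_congr rfl fun i _ => ?_
  split_ifs <;> ring

theorem val_injective {n : ℕ} : Function.Injective (val (n := n)) := by
  induction n with
  | zero => exact fun a b _ => Subsingleton.elim a b
  | succ n ih =>
    intro a b hab
    rw [val_eq_head_add_tail a, val_eq_head_add_tail b] at hab
    have head : a 0 = b 0 := by
      cases ha : a 0 <;> cases hb : b 0 <;> simp [ha, hb] at hab ⊢ <;> omega
    have tail : (fun i : Fin n => a i.succ) = fun i => b i.succ := by
      apply ih
      rw [head] at hab
      omega
    funext i
    exact Fin.cases head (fun j => congrFun tail j) i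

theorem eq_or_genLT_or_genLT {n r : ℕ} (p q : Gen n r) : p = q ∨ genLT p q ∨ genLT q p := by
  rcases lt_trichotomy (hammingDist p.fst p.snd) (hammingDist q.fst q.snd) with hd | hd | hd
  · exact .inr (.inl (.inl hd))
  · rcases lt_trichotomy (val p.fst) (val q.fst) with hf | hf | hf
    · exact .inr (.inl (.inr ⟨hd, .inl hf⟩))
    · have hfst := val_injective hf
      rcases lt_trichotomy (val p.snd) (val q.snd) with hs | hs | hs
      · exact .inr (.inl (.inr ⟨hd, .inr ⟨hfst, hs⟩⟩))
      · have hsnd := val_injective hs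
        cases p
        cases q
        simp_all
      · exact .inr (.inr (.inr ⟨hd.symm, .inr ⟨hfst.symm, hs⟩⟩))
    · exact .inr (.inr (.inr ⟨hd.symm, .inl hf⟩))
  · exact .inr (.inr (.inl hd))

theorem hammingDist_antipode {n : ℕ} (a : Fin n → Bool) :
    hammingDist a (fun i => !(a i)) = n := by
  simp [hammingDist]

/-- Every antipodal pair is the set of endpoints of a generator of distance `n`. -/
theorem exists_gen_ends_eq_antipodal {n r : ℕ} (h : r < n) (a : Fin n → Bool) :
    ∃ g : Gen n r, hammingDist g.fst g.snd = n ∧ ends g = {a, fun i => !(a i)} := by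
  have dist := hammingDist_antipode a
  have hne : val a ≠ val (fun i => !(a i)) := fun heq => by
    rw [← val_injective heq, hammingDist_self] at dist
    omega
  rcases hne.lt_or_gt with hlt | hlt
  · exact ⟨⟨a, _, hlt, by rwa [dist]⟩, dist, rfl⟩
  · rw [hammingDist_comm] at dist
    exact ⟨⟨_, a, hlt, by rwa [dist]⟩, dist, Set.pair_comm _ _⟩

/-- Let `0 ≤ r < n` and let `J` be a finite set of generators each of Hamming
distance `< n` (hence disjoint from `Θ_n`), with `J ∪ Θ_n` admissible.  Then no
vertex `a ∈ Q_n` is such that both `a` and its antipode `ā` occur as endpoints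
of (possibly different) generators in `J`. -/
theorem no_antipodal_endpoints_of_admissible_union_theta (n r : ℕ) (h : r < n)
    (J : Set (Gen n r)) (hfin : J.Finite)
    (hd : ∀ p ∈ J, hammingDist p.fst p.snd < n)
    (hadm : admissible (J ∪ Theta n r)) :
    ¬ ∃ a : Fin n → Bool,
        (∃ p ∈ J, a ∈ ends p) ∧ (∃ q ∈ J, (fun i => !(a i)) ∈ ends q) := by
  rintro ⟨a, ⟨p, hp, hap⟩, q, hq, haq⟩
  obtain ⟨g, hg, hends⟩ := exists_gen_ends_eq_antipodal h a
  have not_le : ∀ m ∈ J, (p = m ∨ genLT p m) → (q = m ∨ genLT q m) → False := by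
    intro m hm hpm hqm
    refine hadm m (.inl hm) g (.inl ((hd m hm).trans_eq hg.symm)) ?_
    rw [hends]
    rintro x (rfl | rfl)
    · exact ⟨p, .inl hp, hpm, hap⟩
    · exact ⟨q, .inl hq, hqm, haq⟩
  rcases eq_or_genLT_or_genLT p q with hpq | hpq | hpq
  · exact not_le q hq (.inl hpq) (.inl rfl)
  · exact not_le q hq (.inr hpq) (.inl rfl)
  · exact not_le p hp (.inl rfl) (.inr hpq)
end

section
/- Let v ∈ Q_5 and let {i,j,k,l,m} = {1,2,3,4,5}. Consider the five pairs P_1 = {v^i, v^{jklm}}, P_2 = {v^j, v^{iklm}}, P_3 = {v^{kl}, v^{ijm}}, P_4 = {v^{km}, v^{ijl}}, P_5 = {v^{lm}, v^{ijk}}. Then the ten vertices are pairwise distinct, the two vertices of each pair are at Hamming distance 5, and any two vertices lying in different pairs are at Hamming distance at most 3. Consequently, every subset of these ten vertices containing no complete pair has Hamming diameter at most 3, so the join P_1 * P_2 * P_3 * P_4 * P_5 (the boundary of a 5-dimensional cross polytope) is a subcomplex of VR(Q_5;3). -/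
/-- `flipSet v T` is the vertex `v^T` of `Q_5` obtained from `v` by flipping the
coordinates in `T`. -/
def flipSet (v : Fin 5 → Bool) (T : Finset (Fin 5)) : Fin 5 → Bool :=
  fun x => if x ∈ T then !(v x) else v x

open scoped symmDiff in
theorem hammingDist_flipSet (v : Fin 5 → Bool) (S T : Finset (Fin 5)) :
    hammingDist (flipSet v S) (flipSet v T) = (S ∆ T).card := by
  unfold hammingDist
  congr 1
  ext x
  rw [Finset.mem_filter_univ, Finset.mem_symmDiff]
  by_cases hS : x ∈ S <;> by_cases hT : x ∈ T <;>
    simp [flipSet, hS, hT]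

/-- The flipped coordinate sets of family (C) for `(i, j, k, l, m) = (0, 1, 2, 3, 4)`; the Boolean
selects the first (`true`) or the second (`false`) vertex of the pair. -/
def modelSet (x : Fin 5 × Bool) : Finset (Fin 5) :=
  if x.2 then ![{0}, {1}, {2, 3}, {2, 4}, {3, 4}] x.1
  else ![{1, 2, 3, 4}, {0, 2, 3, 4}, {0, 1, 4}, {0, 1, 3}, {0, 1, 2}] x.1

open scoped symmDiff in
theorem card_symmDiff_modelSet (x y : Fin 5 × Bool) :
    ((modelSet x ∆ modelSet y).card = 0 → x = y) ∧
      (x.1 = y.1 → x.2 ≠ y.2 → (modelSet x ∆ modelSet y).card = 5) ∧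
      (x.1 ≠ y.1 → (modelSet x ∆ modelSet y).card ≤ 3) := by
  revert x y
  decide

/-- Family (C): for `v ∈ Q_5` and `{i,j,k,l,m} = {1,…,5}`, the five pairs
`P_1 = {v^i, v^{jklm}}`, `P_2 = {v^j, v^{iklm}}`, `P_3 = {v^{kl}, v^{ijm}}`,
`P_4 = {v^{km}, v^{ijl}}`, `P_5 = {v^{lm}, v^{ijk}}` consist of ten pairwise
distinct vertices, each pair at Hamming distance 5, while vertices in
different pairs are at Hamming distance at most 3.  Consequently every subset
of the ten vertices containing no complete pair has Hamming diameter at most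
3, so the join `P_1 * … * P_5` (the boundary of a 5-dimensional cross
polytope) is a subcomplex of `VR(Q_5;3)`. -/
theorem crossPolytope_family_C (v : Fin 5 → Bool) (i j k l m : Fin 5)
    (hcov : ({i, j, k, l, m} : Finset (Fin 5)) = Finset.univ)
    (P : Fin 5 → ((Fin 5 → Bool) × (Fin 5 → Bool)))
    (hP0 : P 0 = (flipSet v {i}, flipSet v {j, k, l, m}))
    (hP1 : P 1 = (flipSet v {j}, flipSet v {i, k, l, m}))
    (hP2 : P 2 = (flipSet v {k, l}, flipSet v {i, j, m}))
    (hP3 : P 3 = (flipSet v {k, m}, flipSet v {i, j, l}))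
    (hP4 : P 4 = (flipSet v {l, m}, flipSet v {i, j, k})) :
    (Function.Injective
      (fun x : Fin 5 × Bool => if x.2 then (P x.1).1 else (P x.1).2)) ∧
    (∀ t : Fin 5, hammingDist (P t).1 (P t).2 = 5) ∧
    (∀ t s : Fin 5, t ≠ s → ∀ x y : Fin 5 → Bool,
      (x = (P t).1 ∨ x = (P t).2) → (y = (P s).1 ∨ y = (P s).2) →
      hammingDist x y ≤ 3) ∧
    (∀ σ : Finset (Fin 5 → Bool),
      (∀ x ∈ σ, ∃ t : Fin 5, x = (P t).1 ∨ x = (P t).2) →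
      (∀ t : Fin 5, ¬ ((P t).1 ∈ σ ∧ (P t).2 ∈ σ)) →
      ∀ x ∈ σ, ∀ y ∈ σ, hammingDist x y ≤ 3) := by
  set g : Fin 5 × Bool → Fin 5 → Bool :=
    fun x => if x.2 then (P x.1).1 else (P x.1).2 with hg
  have hsurj : Function.Surjective ![i, j, k, l, m] := by
    intro x
    have hx : x ∈ ({i, j, k, l, m} : Finset (Fin 5)) := hcov ▸ Finset.mem_univ x
    simp only [Finset.mem_insert, Finset.mem_singleton] at hx
    rcases hx with rfl | rfl | rfl | rfl | rfl
    exacts [⟨0, rfl⟩, ⟨1, rfl⟩, ⟨2, rfl⟩, ⟨3, rfl⟩, ⟨4, rfl⟩]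
  have hinj : Function.Injective ![i, j, k, l, m] := Finite.injective_iff_surjective.mpr hsurj
  have hmodel (x : Fin 5 × Bool) :
      g x = flipSet v ((modelSet x).image ![i, j, k, l, m]) := by
    obtain ⟨t, b⟩ := x
    fin_cases t <;> cases b <;>
      simp [hg, modelSet, hP0, hP1, hP2, hP3, hP4, Finset.image_insert]
  have hdist (x y : Fin 5 × Bool) :
      hammingDist (g x) (g y) = (symmDiff (modelSet x) (modelSet y)).card := by
    rw [hmodel, hmodel, hammingDist_flipSet, ← Finset.image_symmDiff _ _ hinj,
      Finset.card_image_of_injective _ hinj]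
  have hvertex (t : Fin 5) (x : Fin 5 → Bool) (hx : x = (P t).1 ∨ x = (P t).2) :
      ∃ b, x = g (t, b) := by
    rcases hx with rfl | rfl
    exacts [⟨true, rfl⟩, ⟨false, rfl⟩]
  have hfar (t s : Fin 5) (hts : t ≠ s) (x y : Fin 5 → Bool)
      (hx : x = (P t).1 ∨ x = (P t).2) (hy : y = (P s).1 ∨ y = (P s).2) :
      hammingDist x y ≤ 3 := by
    obtain ⟨b, rfl⟩ := hvertex t x hx
    obtain ⟨c, rfl⟩ := hvertex s y hy
    rw [hdist]
    exact (card_symmDiff_modelSet (t, b) (s, c)).2.2 hts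
  refine ⟨fun x y hxy => ?_, fun t => ?_, hfar, fun σ hσ hpair x hx y hy => ?_⟩
  · refine (card_symmDiff_modelSet x y).1 ?_
    rw [← hdist, hammingDist_eq_zero]
    exact hxy
  · exact (hdist (t, true) (t, false)).trans
      ((card_symmDiff_modelSet (t, true) (t, false)).2.1 rfl Bool.noConfusion)
  · obtain ⟨t, ht⟩ := hσ x hx
    obtain ⟨s, hs⟩ := hσ y hy
    by_cases hts : t = s
    · subst hts
      rcases ht with rfl | rfl <;> rcases hs with rfl | rfl
      · simp
      · exact absurd ⟨hx, hy⟩ (hpair t)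
      · exact absurd ⟨hy, hx⟩ (hpair t)
      · simp
    · exact hfar t s hts x y ht hs
end
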